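/- In the clipping ANN setting, assume that f is non-decreasing and satisfies Lip(f) < min_{i ∈ {1,…,h}} v_i w_i, let ϑ ∈ ℝ^{h+1} satisfy (∇L)(ϑ) = 0, and let V = sup_{x ∈ (a,b)} Σ_{j ∈ {1,…,h}, x ∈ I_j^ϑ} v_j. Then (i) for all j ∈ {1,…,h} and x ∈ I_j^ϑ it holds that |N^ϑ(x) − f(x)| ≤ V; (ii) for all j, k ∈ {1,…,h} with I_j^ϑ ≠ ∅ ≠ I_k^ϑ and all x ∈ [sup I_j^ϑ, inf I_k^ϑ] it holds that |N^ϑ(x) − f(x)| ≤ V; (iii) for all j ∈ {1,…,h} with I_j^ϑ ≠ ∅ and all x ∈ [sup I_j^ϑ, b] it holds that |N^ϑ(x) − f(x)| ≤ max{V, |f(b) − N^ϑ(b)|}; and (iv) for all j ∈ {1,…,h} with I_j^ϑ ≠ ∅ and all x ∈ [a, inf I_j^ϑ] it holds that |N^ϑ(x) − f(x)| ≤ max{V, |f(a) − N^ϑ(a)|}. -/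

import Mathlib

open MeasureTheory Filter

noncomputable section

/-- The clipping function `x ↦ min{max{x,0},1}`. -/
def clipFn (x : ℝ) : ℝ := min (max x 0) 1

/-- `ψ_i(θ) = -θ_i / w_i`. -/
def psiC {h : ℕ} (w : Fin h → ℝ) (θ : Fin (h + 1) → ℝ) (i : Fin h) : ℝ :=
  -θ i.castSucc / w i

/-- The activity interval `I_i^θ = (ψ_i(θ), ψ_i(θ) + 1/w_i) ∩ (a, b)`. -/
def actI {h : ℕ} (a b : ℝ) (w : Fin h → ℝ) (θ : Fin (h + 1) → ℝ) (i : Fin h) : Set ℝ :=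
  Set.Ioo (psiC w θ i) (psiC w θ i + (w i)⁻¹) ∩ Set.Ioo a b

/-- The realization function `N^θ(x) = θ_{h+1} + ∑_i v_i c(w_i x + θ_i)`. -/
def realC {h : ℕ} (v w : Fin h → ℝ) (θ : Fin (h + 1) → ℝ) (x : ℝ) : ℝ :=
  θ (Fin.last h) + ∑ i : Fin h, v i * clipFn (w i * x + θ i.castSucc)

/-- The risk `L(θ) = ∫_a^b (N^θ(x) - f(x))² p(x) dx`. -/
def riskC {h : ℕ} (a b : ℝ) (v w : Fin h → ℝ) (f p : ℝ → ℝ) (θ : Fin (h + 1) → ℝ) : ℝ :=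
  ∫ x in Set.Ioo a b, (realC v w θ x - f x) ^ 2 * p x

/-- The gradient `∇L(θ)` as a vector of partial derivatives. -/
def gradC {h : ℕ} (a b : ℝ) (v w : Fin h → ℝ) (f p : ℝ → ℝ) (θ : Fin (h + 1) → ℝ) :
    Fin (h + 1) → ℝ :=
  fun k => fderiv ℝ (riskC a b v w f p) θ (Pi.single k 1)

/-- `x` is a descending critical point of `g` : `∇g(x) = 0` and the Hessian quadratic form
admits a negative value. -/
def IsDescCrit {n : ℕ} (g : (Fin n → ℝ) → ℝ) (x : Fin n → ℝ) : Prop :=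
  fderiv ℝ g x = 0 ∧ ∃ u : Fin n → ℝ, iteratedFDeriv ℝ 2 g x ![u, u] < 0

/-- The Euclidean norm on `Fin n → ℝ`. -/
def euclNorm {n : ℕ} (x : Fin n → ℝ) : ℝ := Real.sqrt (∑ i, (x i) ^ 2)

/-- Piecewise polynomial functions. -/
def PiecewisePoly (F : ℝ → ℝ) : Prop :=
  ∃ (K : ℕ) (τ : ℕ → EReal), 0 < K ∧ τ 0 = ⊥ ∧ τ K = ⊤ ∧
    (∀ k, k < K → τ k < τ (k + 1)) ∧
    ∀ k, k < K → ∃ q : Polynomial ℝ, ∀ x : ℝ,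
      τ k < (x : EReal) → (x : EReal) < τ (k + 1) → F x = q.eval x

theorem clipFn_mono : Monotone clipFn := fun _ _ hxy =>
  min_le_min_right _ (max_le_max_right _ hxy)

theorem continuous_clipFn : Continuous clipFn := by
  unfold clipFn; fun_prop

theorem clipFn_nonneg (x : ℝ) : 0 ≤ clipFn x := le_min (le_max_right _ _) zero_le_one

theorem clipFn_le_one (x : ℝ) : clipFn x ≤ 1 := min_le_right _ _

theorem clipFn_of_mem {x : ℝ} (hx : x ∈ Set.Icc (0 : ℝ) 1) : clipFn x = x := by
  rw [clipFn, max_eq_left hx.1, min_eq_left hx.2]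

theorem clipFn_of_nonpos {x : ℝ} (hx : x ≤ 0) : clipFn x = 0 := by
  rw [clipFn, max_eq_right hx, min_eq_left zero_le_one]

theorem clipFn_of_one_le {x : ℝ} (hx : 1 ≤ x) : clipFn x = 1 := by
  rw [clipFn, max_eq_left (zero_le_one.trans hx), min_eq_right hx]

theorem abs_clipFn_sub_le (x y : ℝ) : |clipFn x - clipFn y| ≤ |x - y| :=
  (abs_min_sub_min_le_max _ _ _ _).trans <| by
    simpa using abs_max_sub_max_le_abs x y 0

theorem hasDerivAt_clipFn {x : ℝ} (h0 : x ≠ 0) (h1 : x ≠ 1) :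
    HasDerivAt clipFn ((Set.Ioo (0 : ℝ) 1).indicator (fun _ => 1) x) x := by
  rcases lt_or_gt_of_ne h0 with h0 | h0
  · rw [Set.indicator_of_notMem (fun h => h0.not_gt h.1)]
    refine (hasDerivAt_const x (0 : ℝ)).congr_of_eventuallyEq ?_
    filter_upwards [Iio_mem_nhds h0] with y hy using clipFn_of_nonpos (le_of_lt hy)
  rcases lt_or_gt_of_ne h1 with h1 | h1
  · rw [Set.indicator_of_mem (show x ∈ Set.Ioo (0 : ℝ) 1 from ⟨h0, h1⟩)]
    refine (hasDerivAt_id x).congr_of_eventuallyEq ?_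
    filter_upwards [Ioo_mem_nhds h0 h1] with y hy using clipFn_of_mem ⟨hy.1.le, hy.2.le⟩
  · rw [Set.indicator_of_notMem (fun h => h1.not_gt h.2)]
    refine (hasDerivAt_const x (1 : ℝ)).congr_of_eventuallyEq ?_
    filter_upwards [Ioi_mem_nhds h1] with y hy using clipFn_of_one_le (le_of_lt hy)

section Realization

variable {h : ℕ} {a b : ℝ} {v w : Fin h → ℝ} {f p : ℝ → ℝ}

theorem mem_Ioo_psiC_iff (hw : ∀ i, 0 < w i) (θ : Fin (h + 1) → ℝ) (i : Fin h) (x : ℝ) :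
    x ∈ Set.Ioo (psiC w θ i) (psiC w θ i + (w i)⁻¹) ↔
      w i * x + θ i.castSucc ∈ Set.Ioo (0 : ℝ) 1 := by
  have e : psiC w θ i + (w i)⁻¹ = (1 - θ i.castSucc) / w i := by
    rw [psiC, inv_eq_one_div, ← add_div, add_comm, ← sub_eq_add_neg]
  rw [e, psiC, Set.mem_Ioo, Set.mem_Ioo, div_lt_iff₀ (hw i), lt_div_iff₀ (hw i), mul_comm x]
  constructor <;> rintro ⟨h1, h2⟩ <;> constructor <;> linarith

theorem continuous_realC (θ : Fin (h + 1) → ℝ) : Continuous (realC v w θ) := by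
  unfold realC
  have := continuous_clipFn
  fun_prop

theorem realC_mono (hv : ∀ i, 0 < v i) (hw : ∀ i, 0 < w i) (θ : Fin (h + 1) → ℝ) :
    Monotone (realC v w θ) := fun x y hxy => by
  refine add_le_add_right (Finset.sum_le_sum fun i _ => ?_) _
  have := mul_le_mul_of_nonneg_left hxy (hw i).le
  exact mul_le_mul_of_nonneg_left (clipFn_mono (by linarith)) (hv i).le

theorem realC_sub (θ : Fin (h + 1) → ℝ) (x y : ℝ) :
    realC v w θ y - realC v w θ x = ∑ i : Fin h,
      v i * (clipFn (w i * y + θ i.castSucc) - clipFn (w i * x + θ i.castSucc)) := by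
  simp only [realC, mul_sub, Finset.sum_sub_distrib]
  ring

theorem mul_sub_le_realC_sub (hv : ∀ i, 0 < v i) (hw : ∀ i, 0 < w i) {θ : Fin (h + 1) → ℝ}
    {i : Fin h} {x y : ℝ} (hx : x ∈ actI a b w θ i) (hy : y ∈ actI a b w θ i) (hxy : x ≤ y) :
    v i * w i * (y - x) ≤ realC v w θ y - realC v w θ x := by
  rw [realC_sub]
  have key : v i * w i * (y - x) =
      v i * (clipFn (w i * y + θ i.castSucc) - clipFn (w i * x + θ i.castSucc)) := by
    rw [clipFn_of_mem (Set.Ioo_subset_Icc_self ((mem_Ioo_psiC_iff hw θ i x).1 hx.1)),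
      clipFn_of_mem (Set.Ioo_subset_Icc_self ((mem_Ioo_psiC_iff hw θ i y).1 hy.1))]
    ring
  rw [key]
  refine Finset.single_le_sum (f := fun i => v i * (clipFn (w i * y + θ i.castSucc)
    - clipFn (w i * x + θ i.castSucc))) (fun k _ => ?_) (Finset.mem_univ i)
  have := mul_le_mul_of_nonneg_left hxy (hw k).le
  exact mul_nonneg (hv k).le (sub_nonneg.2 (clipFn_mono (by linarith)))

theorem clipFn_eq_of_disjoint (hw : ∀ i, 0 < w i) {θ : Fin (h + 1) → ℝ} {i : Fin h} {x y : ℝ}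
    (hax : a ≤ x) (hyb : y ≤ b) (hxy : x ≤ y) (hd : ∀ z ∈ actI a b w θ i, z ∉ Set.Ioo x y) :
    clipFn (w i * y + θ i.castSucc) = clipFn (w i * x + θ i.castSucc) := by
  have hwi := hw i
  have hle := mul_le_mul_of_nonneg_left hxy hwi.le
  by_cases h0 : w i * y + θ i.castSucc ≤ 0
  · rw [clipFn_of_nonpos h0, clipFn_of_nonpos (by linarith)]
  by_cases h1 : 1 ≤ w i * x + θ i.castSucc
  · rw [clipFn_of_one_le h1, clipFn_of_one_le (by linarith)]
  push Not at h0 h1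
  rcases hxy.eq_or_lt with rfl | hlt
  · rfl
  exfalso
  have e : psiC w θ i + (w i)⁻¹ = (1 - θ i.castSucc) / w i := by
    rw [psiC, inv_eq_one_div, ← add_div, add_comm, ← sub_eq_add_neg]
  have hm : max x (psiC w θ i) < min y (psiC w θ i + (w i)⁻¹) := by
    refine max_lt (lt_min hlt ?_) (lt_min ?_ (lt_add_of_pos_right _ (inv_pos.2 hwi)))
    · rw [e, lt_div_iff₀ hwi]; linarith
    · rw [psiC, div_lt_iff₀ hwi]; linarith
  obtain ⟨z, hz1, hz2⟩ := exists_between hm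
  rw [max_lt_iff] at hz1
  rw [lt_min_iff] at hz2
  exact hd z ⟨⟨hz1.2, hz2.2⟩, hax.trans_lt hz1.1, hz2.1.trans_le hyb⟩ ⟨hz1.1, hz2.1⟩

/-- The increment of the realization over `[x, y]` is bounded by the sum of the outer weights of
the neurons active at `z`, if every neuron active somewhere in `(x, y)` is active at `z`. -/
theorem realC_sub_le_sum_indicator (hv : ∀ i, 0 < v i) (hw : ∀ i, 0 < w i)
    {θ : Fin (h + 1) → ℝ} {x y z : ℝ} (hax : a ≤ x) (hyb : y ≤ b) (hxy : x ≤ y)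
    (hz : ∀ i, ∀ u ∈ actI a b w θ i, u ∈ Set.Ioo x y → z ∈ actI a b w θ i) :
    realC v w θ y - realC v w θ x ≤
      ∑ j : Fin h, (actI a b w θ j).indicator (fun _ => v j) z := by
  rw [realC_sub]
  refine Finset.sum_le_sum fun i _ => ?_
  by_cases hi : z ∈ actI a b w θ i
  · rw [Set.indicator_of_mem hi]
    have h1 := clipFn_le_one (w i * y + θ i.castSucc)
    have h2 := clipFn_nonneg (w i * x + θ i.castSucc)
    exact mul_le_of_le_one_right (hv i).le (by linarith)
  · rw [Set.indicator_of_notMem hi, clipFn_eq_of_disjoint hw hax hyb hxy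
      fun u hu hu' => hi (hz i u hu hu'), sub_self, mul_zero]

theorem realC_eq_of_disjoint (hw : ∀ i, 0 < w i) {θ : Fin (h + 1) → ℝ} {x y : ℝ}
    (hax : a ≤ x) (hyb : y ≤ b) (hxy : x ≤ y)
    (hd : ∀ i, ∀ z ∈ actI a b w θ i, z ∉ Set.Ioo x y) :
    realC v w θ y = realC v w θ x := by
  rw [← sub_eq_zero, realC_sub]
  exact Finset.sum_eq_zero fun i _ => by
    rw [clipFn_eq_of_disjoint hw hax hyb hxy (hd i), sub_self, mul_zero]

theorem sum_indicator_le_sSup (hv : ∀ i, 0 < v i) (θ : Fin (h + 1) → ℝ) {z : ℝ}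
    (hz : z ∈ Set.Ioo a b) :
    ∑ j : Fin h, (actI a b w θ j).indicator (fun _ => v j) z ≤
      sSup ((fun x => ∑ j : Fin h, (actI a b w θ j).indicator (fun _ => v j) x) ''
        Set.Ioo a b) := by
  refine le_csSup ⟨∑ j, v j, ?_⟩ (Set.mem_image_of_mem _ hz)
  rintro _ ⟨x, -, rfl⟩
  exact Finset.sum_le_sum fun j _ => Set.indicator_le_self' (fun _ _ => (hv j).le) x

theorem ordConnected_actI (θ : Fin (h + 1) → ℝ) (i : Fin h) :
    (actI a b w θ i).OrdConnected :=
  Set.ordConnected_Ioo.inter Set.ordConnected_Ioo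

theorem isOpen_actI (θ : Fin (h + 1) → ℝ) (i : Fin h) : IsOpen (actI a b w θ i) :=
  isOpen_Ioo.inter isOpen_Ioo

end Realization

section Gradient

variable {h : ℕ} {a b : ℝ} {v w : Fin h → ℝ} {f p : ℝ → ℝ}

/-- The derivative of `θ ↦ N^θ(x)`, for `x` outside the finitely many kinks of the neurons. -/
def realCDeriv (v w : Fin h → ℝ) (θ : Fin (h + 1) → ℝ) (x : ℝ) :
    (Fin (h + 1) → ℝ) →L[ℝ] ℝ :=
  ContinuousLinearMap.proj (Fin.last h) + ∑ i : Fin h,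
    (v i * (Set.Ioo (0 : ℝ) 1).indicator (fun _ => 1) (w i * x + θ i.castSucc)) •
      (ContinuousLinearMap.proj i.castSucc : (Fin (h + 1) → ℝ) →L[ℝ] ℝ)

theorem hasFDerivAt_realC {θ : Fin (h + 1) → ℝ} {x : ℝ}
    (h0 : ∀ i : Fin h, w i * x + θ i.castSucc ≠ 0)
    (h1 : ∀ i : Fin h, w i * x + θ i.castSucc ≠ 1) :
    HasFDerivAt (fun θ => realC v w θ x) (realCDeriv v w θ x) θ := by
  refine (hasFDerivAt_apply (𝕜 := ℝ) (F' := fun _ => ℝ) (Fin.last h) θ).add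
    (HasFDerivAt.fun_sum fun i _ => ?_)
  have hi := (hasDerivAt_clipFn (h0 i) (h1 i)).comp_hasFDerivAt θ
    ((hasFDerivAt_apply (𝕜 := ℝ) (F' := fun _ => ℝ) i.castSucc θ).const_add (w i * x))
  rw [mul_smul]
  exact hi.const_mul (v i)

theorem measurable_realCDeriv (θ : Fin (h + 1) → ℝ) : Measurable (realCDeriv v w θ) := by
  unfold realCDeriv
  refine measurable_const.add (Finset.measurable_fun_sum _ fun i _ => ?_)
  refine Measurable.smul_const (measurable_const.mul ?_) _
  exact (measurable_const.indicator measurableSet_Ioo).comp (by fun_prop)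

theorem realCDeriv_single (hw : ∀ i, 0 < w i) (θ : Fin (h + 1) → ℝ) (i : Fin h) {x : ℝ}
    (hx : x ∈ Set.Ioo a b) :
    realCDeriv v w θ x (Pi.single i.castSucc 1) =
      (actI a b w θ i).indicator (fun _ => v i) x := by
  have hsum : ∀ j : Fin h, (Pi.single i.castSucc (1 : ℝ) : Fin (h + 1) → ℝ) j.castSucc =
      if j = i then 1 else 0 := fun j => by
    simp [Pi.single_apply]
  have hmem : x ∈ actI a b w θ i ↔ w i * x + θ i.castSucc ∈ Set.Ioo (0 : ℝ) 1 :=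
    ⟨fun h => (mem_Ioo_psiC_iff hw θ i x).1 h.1, fun h => ⟨(mem_Ioo_psiC_iff hw θ i x).2 h, hx⟩⟩
  have hlast : (Pi.single i.castSucc (1 : ℝ) : Fin (h + 1) → ℝ) (Fin.last h) = 0 :=
    Pi.single_eq_of_ne (Fin.castSucc_lt_last i).ne' _
  simp only [realCDeriv, add_apply, ContinuousLinearMap.proj_apply, sum_apply, smul_apply, hlast,
    hsum, smul_eq_mul, mul_ite, mul_one, mul_zero, zero_add, Finset.sum_ite_eq', Finset.mem_univ,
    if_true]
  by_cases hxi : x ∈ actI a b w θ i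
  · rw [Set.indicator_of_mem hxi, Set.indicator_of_mem (hmem.1 hxi), mul_one]
  · rw [Set.indicator_of_notMem hxi, Set.indicator_of_notMem (mt hmem.2 hxi), mul_zero]

theorem abs_realC_sub_le (hv : ∀ i, 0 < v i) (θ θ' : Fin (h + 1) → ℝ) (x : ℝ) :
    |realC v w θ x - realC v w θ' x| ≤ (1 + ∑ i, v i) * ‖θ - θ'‖ := by
  have e : realC v w θ x - realC v w θ' x = (θ - θ') (Fin.last h) + ∑ i : Fin h,
      v i * (clipFn (w i * x + θ i.castSucc) - clipFn (w i * x + θ' i.castSucc)) := by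
    simp only [realC, mul_sub, Finset.sum_sub_distrib, Pi.sub_apply]
    ring
  rw [e, add_mul, one_mul, Finset.sum_mul]
  refine (abs_add_le _ _).trans (add_le_add (norm_le_pi_norm (θ - θ') _) ?_)
  refine (Finset.abs_sum_le_sum_abs _ _).trans (Finset.sum_le_sum fun i _ => ?_)
  rw [abs_mul, abs_of_pos (hv i)]
  refine mul_le_mul_of_nonneg_left ((abs_clipFn_sub_le _ _).trans ?_) (hv i).le
  rw [add_sub_add_left_eq_sub]
  exact norm_le_pi_norm (θ - θ') i.castSucc

theorem abs_realC_le (hv : ∀ i, 0 < v i) (θ : Fin (h + 1) → ℝ) (x : ℝ) :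
    |realC v w θ x| ≤ ‖θ‖ + ∑ i, v i := by
  refine (abs_add_le _ _).trans (add_le_add (norm_le_pi_norm θ _) ?_)
  refine (Finset.abs_sum_le_sum_abs _ _).trans (Finset.sum_le_sum fun i _ => ?_)
  rw [abs_mul, abs_of_pos (hv i), abs_of_nonneg (clipFn_nonneg _)]
  exact mul_le_of_le_one_right (hv i).le (clipFn_le_one _)

theorem integrable_restrict_Ioo_of_continuous {g : ℝ → ℝ} (hg : Continuous g) (a b : ℝ) :
    Integrable g (volume.restrict (Set.Ioo a b)) :=
  hg.integrableOn_Icc.mono_set Set.Ioo_subset_Icc_self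

theorem hasFDerivAt_riskC (a b : ℝ) (hv : ∀ i, 0 < v i) (hw : ∀ i, 0 < w i)
    (hf : Continuous f) (hp : Continuous p) (θ : Fin (h + 1) → ℝ) :
    Integrable (fun x => (2 * (realC v w θ x - f x) * p x) • realCDeriv v w θ x)
        (volume.restrict (Set.Ioo a b)) ∧
      HasFDerivAt (riskC a b v w f p)
        (∫ x in Set.Ioo a b, (2 * (realC v w θ x - f x) * p x) • realCDeriv v w θ x) θ := by
  have hS : 0 ≤ ∑ i, v i := Finset.sum_nonneg fun i _ => (hv i).le
  have hcont (θ' : Fin (h + 1) → ℝ) : Continuous fun x => (realC v w θ' x - f x) ^ 2 * p x :=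
    (((continuous_realC θ').sub hf).pow 2).mul hp
  refine hasFDerivAt_integral_of_dominated_loc_of_lip
    (F := fun θ x => (realC v w θ x - f x) ^ 2 * p x)
    (bound := fun x => (1 + ∑ i, v i) * (2 * (‖θ‖ + 1 + ∑ i, v i + |f x|)) * |p x|)
    (Metric.ball_mem_nhds θ one_pos) (.of_forall fun θ' => (hcont θ').aestronglyMeasurable)
    (integrable_restrict_Ioo_of_continuous (hcont θ) a b) ?_ (.of_forall fun x => ?_)
    (integrable_restrict_Ioo_of_continuous (by fun_prop) a b) ?_
  · have hc := continuous_realC (v := v) (w := w) θ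
    have hc' : Continuous fun x => 2 * (realC v w θ x - f x) * p x := by fun_prop
    exact hc'.aestronglyMeasurable.smul
      (measurable_realCDeriv θ).aestronglyMeasurable
  · refine LipschitzOnWith.of_dist_le_mul fun θ₁ h₁ θ₂ h₂ => ?_
    have hnorm : ∀ θ' ∈ Metric.ball θ 1, |realC v w θ' x| ≤ ‖θ‖ + 1 + ∑ i, v i := fun θ' h' => by
      have h3 := norm_le_norm_add_norm_sub' θ' θ
      have h4 := mem_ball_iff_norm.1 h'
      linarith [abs_realC_le (w := w) hv θ' x]
    have h₃ := hnorm θ₁ h₁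
    have h₄ := hnorm θ₂ h₂
    rw [Real.coe_nnabs, abs_of_nonneg (by positivity), Real.dist_eq, dist_eq_norm]
    have e : (realC v w θ₁ x - f x) ^ 2 * p x - (realC v w θ₂ x - f x) ^ 2 * p x =
        (realC v w θ₁ x - realC v w θ₂ x) *
          ((realC v w θ₁ x - f x) + (realC v w θ₂ x - f x)) * p x := by ring
    rw [e, abs_mul, abs_mul]
    have h₅ : |(realC v w θ₁ x - f x) + (realC v w θ₂ x - f x)| ≤
        2 * (‖θ‖ + 1 + ∑ i, v i + |f x|) := by
      have h6 := abs_add_le (realC v w θ₁ x - f x) (realC v w θ₂ x - f x)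
      have h7 := abs_sub (realC v w θ₁ x) (f x)
      have h8 := abs_sub (realC v w θ₂ x) (f x)
      linarith
    calc _ ≤ ((1 + ∑ i, v i) * ‖θ₁ - θ₂‖) * (2 * (‖θ‖ + 1 + ∑ i, v i + |f x|)) * |p x| := by
          gcongr
          exact abs_realC_sub_le hv θ₁ θ₂ x
      _ = _ := by ring
  · have hfin : (⋃ i : Fin h, {-θ i.castSucc / w i, (1 - θ i.castSucc) / w i} : Set ℝ).Finite :=
      Set.finite_iUnion fun i => Set.toFinite _
    filter_upwards [ae_restrict_of_ae (hfin.countable.ae_notMem volume)] with x hx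
    simp only [Set.mem_iUnion, Set.mem_insert_iff, Set.mem_singleton_iff, not_exists, not_or] at hx
    have hN := hasFDerivAt_realC (v := v) (w := w) (θ := θ) (x := x)
      (fun i h0 => (hx i).1 (by rw [eq_div_iff (hw i).ne']; linarith))
      (fun i h1 => (hx i).2 (by rw [eq_div_iff (hw i).ne']; linarith))
    refine (((hN.sub_const (f x)).pow 2).mul_const (p x)).congr_fderiv ?_
    rw [smul_smul]
    congr 1
    simp
    ring

/-- At a critical point of the risk, the weighted mean error over each activity interval is
zero. -/
theorem setIntegral_actI_eq_zero (hv : ∀ i, 0 < v i) (hw : ∀ i, 0 < w i)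
    (hf : Continuous f) (hp : Continuous p) {θ : Fin (h + 1) → ℝ}
    (hcrit : fderiv ℝ (riskC a b v w f p) θ = 0) (i : Fin h) :
    ∫ x in actI a b w θ i, (realC v w θ x - f x) * p x = 0 := by
  obtain ⟨hint, hder⟩ := hasFDerivAt_riskC a b hv hw hf hp θ
  have h0 := congrArg (fun T => T (Pi.single i.castSucc (1 : ℝ))) (hder.fderiv.symm.trans hcrit)
  simp only [zero_apply] at h0
  rw [ContinuousLinearMap.integral_apply hint] at h0
  have h1 : ∫ x in Set.Ioo a b, (actI a b w θ i).indicator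
      (fun x => 2 * v i * ((realC v w θ x - f x) * p x)) x = 0 := by
    rw [← h0]
    refine setIntegral_congr_fun measurableSet_Ioo fun x hx => ?_
    simp only [smul_apply, realCDeriv_single hw θ i hx, smul_eq_mul]
    by_cases hxi : x ∈ actI a b w θ i
    · simp only [Set.indicator_of_mem hxi]; ring
    · simp only [Set.indicator_of_notMem hxi, mul_zero]
  rw [setIntegral_indicator (isOpen_actI θ i).measurableSet,
    Set.inter_eq_self_of_subset_right (t := actI a b w θ i) Set.inter_subset_right,
    integral_const_mul] at h1
  exact (mul_eq_zero.1 h1).resolve_left (mul_pos two_pos (hv i)).ne'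

theorem exists_mem_actI_realC_eq (hv : ∀ i, 0 < v i) (hw : ∀ i, 0 < w i)
    (hf : Continuous f) (hp : Continuous p) (hpos : ∀ x ∈ Set.Ioo a b, 0 < p x)
    {θ : Fin (h + 1) → ℝ} (hcrit : fderiv ℝ (riskC a b v w f p) θ = 0) {i : Fin h}
    (hne : (actI a b w θ i).Nonempty) :
    ∃ q ∈ actI a b w θ i, realC v w θ q = f q := by
  have hsub : actI a b w θ i ⊆ Set.Ioo a b := Set.inter_subset_right
  have hint {g : ℝ → ℝ} (hg : Continuous g) : IntegrableOn g (actI a b w θ i) :=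
    IntegrableOn.mono_set (integrable_restrict_Ioo_of_continuous hg a b) hsub
  have hc : Continuous fun x => realC v w θ x - f x := (continuous_realC θ).sub hf
  obtain ⟨q, hq, he⟩ := exists_eq_const_mul_setIntegral_of_nonneg
    ⟨hne, (ordConnected_actI θ i).isPreconnected⟩ (isOpen_actI θ i).measurableSet
    hc.continuousOn (hint hp) (hint (hc.mul hp)) fun x hx => (hpos x (hsub hx)).le
  rw [setIntegral_actI_eq_zero hv hw hf hp hcrit i] at he
  refine ⟨q, hq, sub_eq_zero.1 ((mul_eq_zero.1 he.symm).resolve_right (ne_of_gt ?_))⟩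
  rw [setIntegral_pos_iff_support_of_nonneg_ae
    ((ae_restrict_iff' (isOpen_actI θ i).measurableSet).2
      (.of_forall fun x hx => (hpos x (hsub hx)).le)) (hint hp),
    Set.inter_eq_self_of_subset_right (s := Function.support p) fun x hx => (hpos x (hsub hx)).ne']
  exact (isOpen_actI θ i).measure_pos _ hne

end Gradient

section Bounds

variable {h : ℕ} {a b : ℝ} {v w : Fin h → ℝ} {f : ℝ → ℝ} {θ : Fin (h + 1) → ℝ} {V : ℝ}

/-- An upper bound for the error to the right of a zero of the error lying in an activity
interval. -/
theorem realC_sub_le_of_zero_le (hv : ∀ i, 0 < v i) (hw : ∀ i, 0 < w i) (hfmono : Monotone f)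
    (hV0 : 0 ≤ V)
    (hV : ∀ z ∈ Set.Ioo a b, ∑ j : Fin h, (actI a b w θ j).indicator (fun _ => v j) z ≤ V)
    (hmono : ∀ i, MonotoneOn (fun x => realC v w θ x - f x) (actI a b w θ i))
    {q : Fin h → ℝ} (hq : ∀ i, (actI a b w θ i).Nonempty → q i ∈ actI a b w θ i)
    (hqz : ∀ i, (actI a b w θ i).Nonempty → realC v w θ (q i) = f (q i))
    {x : ℝ} (hx : x ∈ Set.Icc a b) {j : Fin h} (hj : (actI a b w θ j).Nonempty)
    (hjx : q j ≤ x) : realC v w θ x - f x ≤ V := by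
  by_cases hex : ∃ i, x ∈ actI a b w θ i ∧ x ≤ q i
  · obtain ⟨i, hxi, hxq⟩ := hex
    have := hmono i hxi (hq i ⟨x, hxi⟩) hxq
    simp only [hqz i ⟨x, hxi⟩, sub_self] at this
    exact this.trans hV0
  push Not at hex
  obtain ⟨l, ⟨hl, hlx⟩, hmax⟩ := (Set.toFinite
    {i | (actI a b w θ i).Nonempty ∧ q i ≤ x}).exists_maximalFor q _ ⟨j, hj, hjx⟩
  have hle : ∀ i, (actI a b w θ i).Nonempty → q i ≤ x → q i ≤ q l := fun i hi hix =>
    (le_total (q i) (q l)).elim id fun h => hmax ⟨hi, hix⟩ h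
  have hinc := realC_sub_le_sum_indicator (z := q l) hv hw (hq l hl).2.1.le hx.2 hlx
    fun i u hu hu' => by
      have hi : (actI a b w θ i).Nonempty := ⟨u, hu⟩
      have hix : q i ≤ x := by
        by_contra! hlt
        exact (hex i ((ordConnected_actI θ i).out hu (hq i hi) ⟨hu'.2.le, hlt.le⟩)).not_gt hlt
      exact (ordConnected_actI θ i).out (hq i hi) hu ⟨hle i hi hix, hu'.1.le⟩
  have h1 := hV (q l) (hq l hl).2
  have h2 := hqz l hl
  have h3 := hfmono hlx
  linarith

/-- A lower bound for the error to the left of a zero of the error lying in an activity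
interval. -/
theorem sub_realC_le_of_le_zero (hv : ∀ i, 0 < v i) (hw : ∀ i, 0 < w i) (hfmono : Monotone f)
    (hV0 : 0 ≤ V)
    (hV : ∀ z ∈ Set.Ioo a b, ∑ j : Fin h, (actI a b w θ j).indicator (fun _ => v j) z ≤ V)
    (hmono : ∀ i, MonotoneOn (fun x => realC v w θ x - f x) (actI a b w θ i))
    {q : Fin h → ℝ} (hq : ∀ i, (actI a b w θ i).Nonempty → q i ∈ actI a b w θ i)
    (hqz : ∀ i, (actI a b w θ i).Nonempty → realC v w θ (q i) = f (q i))
    {x : ℝ} (hx : x ∈ Set.Icc a b) {j : Fin h} (hj : (actI a b w θ j).Nonempty)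
    (hjx : x ≤ q j) : f x - realC v w θ x ≤ V := by
  by_cases hex : ∃ i, x ∈ actI a b w θ i ∧ q i ≤ x
  · obtain ⟨i, hxi, hxq⟩ := hex
    have := hmono i (hq i ⟨x, hxi⟩) hxi hxq
    simp only [hqz i ⟨x, hxi⟩, sub_self] at this
    linarith
  push Not at hex
  obtain ⟨l, ⟨hl, hlx⟩, hmin⟩ := (Set.toFinite
    {i | (actI a b w θ i).Nonempty ∧ x ≤ q i}).exists_minimalFor q _ ⟨j, hj, hjx⟩
  have hle : ∀ i, (actI a b w θ i).Nonempty → x ≤ q i → q l ≤ q i := fun i hi hix =>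
    (le_total (q l) (q i)).elim id fun h => hmin ⟨hi, hix⟩ h
  have hinc := realC_sub_le_sum_indicator (z := q l) hv hw hx.1 (hq l hl).2.2.le hlx
    fun i u hu hu' => by
      have hi : (actI a b w θ i).Nonempty := ⟨u, hu⟩
      have hix : x ≤ q i := by
        by_contra! hlt
        exact (hex i ((ordConnected_actI θ i).out (hq i hi) hu ⟨hlt.le, hu'.1.le⟩)).not_gt hlt
      exact (ordConnected_actI θ i).out hu (hq i hi) ⟨hu'.2.le, hle i hi hix⟩
  have h1 := hV (q l) (hq l hl).2
  have h2 := hqz l hl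
  have h3 := hfmono hlx
  linarith

end Bounds

theorem statement_7
    (a b : ℝ) (hab : a < b) (h : ℕ) (hh : 0 < h)
    (v w : Fin h → ℝ) (hv : ∀ i, 0 < v i) (hw : ∀ i, 0 < w i)
    (f p : ℝ → ℝ) (hf : Continuous f) (hp : Continuous p)
    (hpnn : ∀ x : ℝ, 0 ≤ p x) (hsupp : {x : ℝ | 0 < p x} = Set.Ioo a b)
    (hfmono : Monotone f)
    -- `Lip(f) < min_i v_i w_i`
    (K : ℝ) (hK : ∀ i, K < v i * w i)
    (hLipf : ∀ x ∈ Set.Icc a b, ∀ y ∈ Set.Icc a b, |f x - f y| ≤ K * |x - y|)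
    (ϑ : Fin (h + 1) → ℝ) (hcrit : fderiv ℝ (riskC a b v w f p) ϑ = 0)
    (V : ℝ)
    (hV : V = sSup ((fun x => ∑ j : Fin h, (actI a b w ϑ j).indicator (fun _ => v j) x) ''
      Set.Ioo a b)) :
    (∀ j : Fin h, ∀ x ∈ actI a b w ϑ j, |realC v w ϑ x - f x| ≤ V) ∧
    (∀ j k : Fin h, (actI a b w ϑ j).Nonempty → (actI a b w ϑ k).Nonempty →
      ∀ x ∈ Set.Icc (sSup (actI a b w ϑ j)) (sInf (actI a b w ϑ k)),
        |realC v w ϑ x - f x| ≤ V) ∧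
    (∀ j : Fin h, (actI a b w ϑ j).Nonempty →
      ∀ x ∈ Set.Icc (sSup (actI a b w ϑ j)) b,
        |realC v w ϑ x - f x| ≤ max V |f b - realC v w ϑ b|) ∧
    (∀ j : Fin h, (actI a b w ϑ j).Nonempty →
      ∀ x ∈ Set.Icc a (sInf (actI a b w ϑ j)),
        |realC v w ϑ x - f x| ≤ max V |f a - realC v w ϑ a|) := by
  have hpos : ∀ x ∈ Set.Ioo a b, 0 < p x := fun x hx => by
    rw [← hsupp] at hx; exact hx
  have hVz : ∀ z ∈ Set.Ioo a b,
      ∑ j : Fin h, (actI a b w ϑ j).indicator (fun _ => v j) z ≤ V := fun z hz =>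
    hV ▸ sum_indicator_le_sSup hv ϑ hz
  have hV0 : 0 ≤ V := by
    obtain ⟨z, hz⟩ := Set.nonempty_Ioo.2 hab
    exact (Finset.sum_nonneg fun j _ => Set.indicator_nonneg (fun _ _ => (hv j).le) z).trans
      (hVz z hz)
  have hmono : ∀ i, MonotoneOn (fun x => realC v w ϑ x - f x) (actI a b w ϑ i) := by
    intro i x hx y hy hxy
    have h1 := mul_sub_le_realC_sub hv hw hx hy hxy
    have h2 := hLipf y (Set.Ioo_subset_Icc_self hy.2) x (Set.Ioo_subset_Icc_self hx.2)
    rw [abs_of_nonneg (sub_nonneg.2 hxy)] at h2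
    have h3 := mul_le_mul_of_nonneg_right (hK i).le (sub_nonneg.2 hxy)
    have h4 := le_abs_self (f y - f x)
    simp only
    linarith
  have hex : ∀ i, ∃ q, (actI a b w ϑ i).Nonempty →
      q ∈ actI a b w ϑ i ∧ realC v w ϑ q = f q := fun i => by
    by_cases hne : (actI a b w ϑ i).Nonempty
    · obtain ⟨q, hq⟩ := exists_mem_actI_realC_eq hv hw hf hp hpos hcrit hne
      exact ⟨q, fun _ => hq⟩
    · exact ⟨0, fun hne' => absurd hne' hne⟩
  choose q hq' using hex
  have hq := fun i hi => (hq' i hi).1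
  have hqz := fun i hi => (hq' i hi).2
  have upper {x : ℝ} (hx : x ∈ Set.Icc a b) {j : Fin h} (hj : (actI a b w ϑ j).Nonempty)
      (hjx : q j ≤ x) : realC v w ϑ x - f x ≤ V :=
    realC_sub_le_of_zero_le hv hw hfmono hV0 hVz hmono hq hqz hx hj hjx
  have lower {x : ℝ} (hx : x ∈ Set.Icc a b) {j : Fin h} (hj : (actI a b w ϑ j).Nonempty)
      (hjx : x ≤ q j) : f x - realC v w ϑ x ≤ V :=
    sub_realC_le_of_le_zero hv hw hfmono hV0 hVz hmono hq hqz hx hj hjx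
  have active : ∀ j, ∀ x ∈ actI a b w ϑ j, |realC v w ϑ x - f x| ≤ V := by
    intro j x hx
    have hxab := Set.Ioo_subset_Icc_self hx.2
    have hj : (actI a b w ϑ j).Nonempty := ⟨x, hx⟩
    rw [abs_le]
    rcases le_total (q j) x with hle | hle
    · have h1 := hmono j (hq j hj) hx hle
      simp only [hqz j hj, sub_self] at h1
      exact ⟨by linarith, upper hxab hj hle⟩
    · have h1 := lower hxab hj hle
      have h2 := hmono j hx (hq j hj) hle
      simp only [hqz j hj, sub_self] at h2
      exact ⟨by linarith, h2.trans hV0⟩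
  have q_le_sSup {j : Fin h} (hj : (actI a b w ϑ j).Nonempty) :
      q j ≤ sSup (actI a b w ϑ j) := le_csSup ⟨b, fun _ hz => hz.2.2.le⟩ (hq j hj)
  have sInf_le_q {j : Fin h} (hj : (actI a b w ϑ j).Nonempty) :
      sInf (actI a b w ϑ j) ≤ q j := csInf_le ⟨a, fun _ hz => hz.2.1.le⟩ (hq j hj)
  refine ⟨active, fun j k hj hk x hx => ?_, fun j hj x hx => ?_, fun j hj x hx => ?_⟩
  · have hjx := (q_le_sSup hj).trans hx.1
    have hxk := hx.2.trans (sInf_le_q hk)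
    have hxab : x ∈ Set.Icc a b :=
      ⟨(hq j hj).2.1.le.trans hjx, hxk.trans (hq k hk).2.2.le⟩
    have h1 := lower hxab hk hxk
    exact abs_le.2 ⟨by linarith, upper hxab hj hjx⟩
  · have hjx := (q_le_sSup hj).trans hx.1
    have hxab : x ∈ Set.Icc a b := ⟨(hq j hj).2.1.le.trans hjx, hx.2⟩
    have h1 := upper hxab hj hjx
    by_cases hr : ∃ k, (actI a b w ϑ k).Nonempty ∧ x ≤ q k
    · obtain ⟨k, hk, hxk⟩ := hr
      have h2 := lower hxab hk hxk
      exact le_max_of_le_left (abs_le.2 ⟨by linarith, h1⟩)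
    by_cases ha : ∃ i, x ∈ actI a b w ϑ i
    · obtain ⟨i, hi⟩ := ha
      exact le_max_of_le_left (active i x hi)
    push Not at hr ha
    have h2 := realC_eq_of_disjoint (v := v) hw hxab.1 le_rfl hx.2 fun i z hz hz' =>
      ha i ((ordConnected_actI ϑ i).out (hq i ⟨z, hz⟩) hz ⟨(hr i ⟨z, hz⟩).le, hz'.1.le⟩)
    have h3 := hfmono hx.2
    have h4 := le_abs_self (f b - realC v w ϑ b)
    exact abs_le'.2 ⟨le_max_of_le_left h1, le_max_of_le_right (by linarith)⟩
  · have hxj := hx.2.trans (sInf_le_q hj)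
    have hxab : x ∈ Set.Icc a b := ⟨hx.1, hxj.trans (hq j hj).2.2.le⟩
    have h1 := lower hxab hj hxj
    by_cases hl : ∃ k, (actI a b w ϑ k).Nonempty ∧ q k ≤ x
    · obtain ⟨k, hk, hkx⟩ := hl
      exact le_max_of_le_left (abs_le.2 ⟨by linarith, upper hxab hk hkx⟩)
    by_cases ha : ∃ i, x ∈ actI a b w ϑ i
    · obtain ⟨i, hi⟩ := ha
      exact le_max_of_le_left (active i x hi)
    push Not at hl ha
    have h2 := realC_eq_of_disjoint (v := v) hw le_rfl hxab.2 hx.1 fun i z hz hz' =>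
      ha i ((ordConnected_actI ϑ i).out hz (hq i ⟨z, hz⟩) ⟨hz'.2.le, (hl i ⟨z, hz⟩).le⟩)
    have h3 := hfmono hx.1
    have h4 := neg_abs_le (f a - realC v w ϑ a)
    exact abs_le'.2 ⟨le_max_of_le_right (by linarith), le_max_of_le_left (by linarith)⟩
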